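/- Let k be a commutative ring, ε a unit of k, n ≥ 1, and λ = (λ₁,…,λ_n) ∈ ℕⁿ. Let M be the 2^n × 2^n matrix over k whose rows and columns are indexed by I_n = {0,1}^n, with (δ, β) entry equal to ε^{δ·λ}·(−1)^{β·δ − β·λ}, where x·y = x₁y₁ + ⋯ + x_ny_n. Then det(M) = (−ε)^{2^{n−1}(λ₁+⋯+λ_n)}·(−2)^{n·2^{n−1}}. In particular, if k is a field in which 2 ≠ 0, then M is invertible. -/

import Mathlib

open scoped Kronecker in
/-- The determinant of an iterated Kronecker product of square matrices of the same size. -/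
theorem Matrix.det_of_prod_apply {R m : Type*} [CommRing R] [Fintype m] [DecidableEq m] :
    ∀ (n : ℕ) (A : Fin n → Matrix m m R),
      (Matrix.of fun δ β : Fin n → m => ∏ i, A i (δ i) (β i)).det =
        ∏ i, (A i).det ^ Fintype.card m ^ (n - 1)
  | 0, A => by simp [Matrix.det_unique]
  | n + 1, A => by
    have h : (Matrix.of fun δ β : Fin (n + 1) → m => ∏ i, A i (δ i) (β i)).submatrix
        (Fin.consEquiv fun _ => m) (Fin.consEquiv fun _ => m) =
          A 0 ⊗ₖ (Matrix.of fun δ β : Fin n → m => ∏ i, A i.succ (δ i) (β i)) := by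
      ext ⟨a, δ⟩ ⟨b, β⟩
      simp [Fin.prod_univ_succ, Fin.consEquiv]
    rw [← Matrix.det_submatrix_equiv_self (Fin.consEquiv fun _ => m), h, Matrix.det_kronecker,
      Matrix.det_of_prod_apply n, Fin.prod_univ_succ, ← Finset.prod_pow]
    congr 1
    · simp
    · refine Finset.prod_congr rfl fun i _ => ?_
      rw [← pow_mul, ← pow_succ, Nat.sub_add_cancel (Nat.one_le_of_lt i.pos), Nat.add_sub_cancel]

/-- for a commutative ring `k`, a unit `ε` of `k`, `n ≥ 1` and
`λ ∈ ℕⁿ`, the `2^n × 2^n` matrix over `k` indexed by `I_n = {0,1}^n` with `(δ, β)`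
entry `ε^(δ·λ) · (-1)^(β·δ - β·λ)` has determinant
`(-ε)^(2^(n-1)·(λ₁+⋯+λ_n)) · (-2)^(n·2^(n-1))`. -/
theorem det_eps_sign_matrix {k : Type*} [CommRing k] (ε : kˣ) (n : ℕ) (hn : 1 ≤ n)
    (lam : Fin n → ℕ) :
    Matrix.det (Matrix.of fun δ β : Fin n → Fin 2 =>
        ((ε ^ (∑ i, (δ i).val * lam i) : kˣ) : k) *
          (((-1 : kˣ) ^ ((∑ i, ((β i).val : ℤ) * (δ i).val) -
              ∑ i, ((β i).val : ℤ) * (lam i : ℤ)) : kˣ) : k)) =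
      (((-ε) ^ (2 ^ (n - 1) * ∑ i, lam i) : kˣ) : k) * (-2 : k) ^ (n * 2 ^ (n - 1)) := by
  let A : Fin n → Matrix (Fin 2) (Fin 2) k := fun i => Matrix.of fun d b =>
    ((ε ^ (d.val * lam i) : kˣ) : k) *
      (((-1 : kˣ) ^ ((b.val : ℤ) * d.val - (b.val : ℤ) * (lam i : ℤ)) : kˣ) : k)
  have hA (i : Fin n) : (A i).det = (((-ε) ^ lam i : kˣ) : k) * (-2) := by
    have hneg : ((-ε) ^ lam i : kˣ) = (-1) ^ lam i * ε ^ lam i := neg_pow ε (lam i)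
    have hinv : ((-1 : kˣ) ^ lam i)⁻¹ = (-1) ^ lam i := by rw [← inv_pow, inv_neg_one]
    simp only [A, Matrix.det_fin_two, Matrix.of_apply, hneg]
    simp [zpow_sub, hinv, -Units.val_inv_eq_inv_val]
    ring
  have hM : (Matrix.of fun δ β : Fin n → Fin 2 =>
      ((ε ^ (∑ i, (δ i).val * lam i) : kˣ) : k) *
        (((-1 : kˣ) ^ ((∑ i, ((β i).val : ℤ) * (δ i).val) -
            ∑ i, ((β i).val : ℤ) * (lam i : ℤ)) : kˣ) : k)) =
      Matrix.of fun δ β : Fin n → Fin 2 => ∏ i, A i (δ i) (β i) := by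
    ext δ β
    have hsum (f : Fin n → ℤ) : (-1 : kˣ) ^ (∑ i, f i) = ∏ i, (-1 : kˣ) ^ f i :=
      map_prod (zpowersHom kˣ (-1)) (fun i => Multiplicative.ofAdd (f i)) Finset.univ
    simp only [A, Matrix.of_apply, Finset.prod_mul_distrib]
    rw [← Finset.sum_sub_distrib, hsum, ← Finset.prod_pow_eq_pow_sum, Units.coe_prod,
      Units.coe_prod]
  rw [hM, Matrix.det_of_prod_apply, Finset.prod_congr rfl fun i _ => by rw [hA i],
    Finset.prod_pow, Finset.prod_mul_distrib, mul_pow, Finset.prod_const, Finset.card_univ,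
    Fintype.card_fin, Fintype.card_fin, ← pow_mul, ← Units.coe_prod, Finset.prod_pow_eq_pow_sum,
    ← Units.val_pow_eq_pow_val, ← pow_mul, mul_comm (2 ^ (n - 1))]
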